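/- Let K be a field of characteristic zero, 1 ≤ i < j ≤ m, 1 ≤ k < l ≤ n, and 1 ≤ α ≤ m. Let e_{ij} ∈ lie_m^m be the tuple with x_j in slot i, x_i in slot j, and 0 elsewhere (so D_{e_{ij}} = t^{ij}), and similarly e_{kl} ∈ lie_n^n. Then the composed tangential derivation D_{e_{ij} ∘_α e_{kl}} of lie_{m+n−1} equals T + t^{(k+α−1)(l+α−1)}, where T = t^{(i+n−1)(j+n−1)} if α < i; T = Σ_{β=1}^{n} t^{(i+β−1)(j+n−1)} if α = i; T = t^{i(j+n−1)} if i < α < j; T = Σ_{β=1}^{n} t^{i(j+β−1)} if α = j; and T = t^{ij} if α > j. (In particular, the infinitesimal braid derivations form a suboperad of the special derivations.) -/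

import Mathlib

open FreeLieAlgebra

variable (K : Type) [Field K] [CharZero K]

/-- The free Lie algebra over `K` on `N` generators `x_1, …, x_N`
(indexed here 0-based by `Fin N`). -/
abbrev lieF (N : ℕ) : Type := FreeLieAlgebra K (Fin N)

/-- The `(k+1)`-st generator of `lieF K N` (0-based index `k`), junk value `0` out of range. -/
noncomputable def xg (N k : ℕ) : lieF K N :=
  if h : k < N then FreeLieAlgebra.of K (⟨k, h⟩ : Fin N) else 0

/-- The Lie algebra homomorphism `Φ_i : lie_m → lie_{m+n-1}` sending (0-based) `x_j ↦ x_j`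
for `j < i`, `x_i ↦ x_i + x_{i+1} + ⋯ + x_{i+n-1}`, and `x_j ↦ x_{j+n-1}` for `j > i`. -/
noncomputable def PhiL (m n i : ℕ) : lieF K m →ₗ⁅K⁆ lieF K (m + n - 1) :=
  FreeLieAlgebra.lift K fun j : Fin m =>
    if (j : ℕ) < i then xg K (m + n - 1) (j : ℕ)
    else if (j : ℕ) = i then ∑ t : Fin n, xg K (m + n - 1) (i + (t : ℕ))
    else xg K (m + n - 1) ((j : ℕ) + n - 1)

/-- The Lie algebra homomorphism `Ψ_i : lie_n → lie_{m+n-1}` sending (0-based)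
`x_j ↦ x_{i+j}`. -/
noncomputable def PsiL (m n i : ℕ) : lieF K n →ₗ⁅K⁆ lieF K (m + n - 1) :=
  FreeLieAlgebra.lift K fun j : Fin n => xg K (m + n - 1) (i + (j : ℕ))

/-- The partial composition `f ∘_i g := Φ_i(f) + Ψ_i(g)` of free Lie algebra elements
(the pivot `i` is 0-based). -/
noncomputable def compL {m n : ℕ} (f : lieF K m) (i : ℕ) (g : lieF K n) :
    lieF K (m + n - 1) :=
  PhiL K m n i f + PsiL K m n i g

/-- The canonical identification `lie_N ≅ lie_{N'}` for `N = N'`. -/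
noncomputable def recastL {N N' : ℕ} (hNN : N = N') : lieF K N →ₗ⁅K⁆ lieF K N' :=
  FreeLieAlgebra.lift K fun j => FreeLieAlgebra.of K (Fin.cast hNN j)

/-- Entry of a tuple at a natural-number index (junk value `0` out of range). -/
noncomputable def tget {N : ℕ} (a : Fin N → lieF K N) (k : ℕ) : lieF K N :=
  if h : k < N then a ⟨k, h⟩ else 0

/-- The composed tuple `a ∘_i b ∈ (lie_{m+n-1})^{m+n-1}` (0-based indices): its entries are
`Φ_i(a_j)` in slot `j` for `j < i`, `Φ_i(a_i) + Ψ_i(b_k)` in slot `i+k` for `0 ≤ k < n`,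
and `Φ_i(a_j)` in slot `j+n-1` for `j > i`. -/
noncomputable def compTup {m n : ℕ} (a : Fin m → lieF K m) (i : ℕ)
    (b : Fin n → lieF K n) : Fin (m + n - 1) → lieF K (m + n - 1) := fun k =>
  if (k : ℕ) < i then PhiL K m n i (tget K a (k : ℕ))
  else if (k : ℕ) < i + n then
    PhiL K m n i (tget K a i) + PsiL K m n i (tget K b ((k : ℕ) - i))
  else PhiL K m n i (tget K a ((k : ℕ) + 1 - n))

/-- The Lie algebra of derivations of `lieF K N`. -/
abbrev DerL (N : ℕ) : Type := LieDerivation K (lieF K N) (lieF K N)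

/-- `isT p q T` says that `T` is the derivation `t^{pq}`:  `T(x_p) = [x_p, x_q]`,
`T(x_q) = [x_q, x_p]`, and `T(x_r) = 0` for `r ≠ p, q`. -/
def isT {N : ℕ} (p q : Fin N) (T : DerL K N) : Prop :=
  T (FreeLieAlgebra.of K p) = ⁅FreeLieAlgebra.of K p, FreeLieAlgebra.of K q⁆ ∧
  T (FreeLieAlgebra.of K q) = ⁅FreeLieAlgebra.of K q, FreeLieAlgebra.of K p⁆ ∧
  ∀ r : Fin N, r ≠ p → r ≠ q → T (FreeLieAlgebra.of K r) = 0

/-- The tuple `e_{pq}` with `x_q` in slot `p`, `x_p` in slot `q` and `0` elsewhere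
(0-based indices), so that `D_{e_{pq}} = t^{pq}`. -/
noncomputable def eTup (M p q : ℕ) : Fin M → lieF K M := fun s =>
  if (s : ℕ) = p then xg K M q else if (s : ℕ) = q then xg K M p else 0

/-- A derivation of a free Lie algebra is determined by its values on the generators. -/
theorem lieF_derivation_ext {F : Type} [Field F] {N : ℕ} {D E : DerL F N}
    (h : ∀ s : Fin N, D (FreeLieAlgebra.of F s) = E (FreeLieAlgebra.of F s)) : D = E := by
  let L := LieSubalgebra.lieSpan F (lieF F N) (Set.range (FreeLieAlgebra.of F))
  let f : lieF F N →ₗ⁅F⁆ L := FreeLieAlgebra.lift F fun s =>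
    ⟨FreeLieAlgebra.of F s, LieSubalgebra.subset_lieSpan ⟨s, rfl⟩⟩
  have hf : L.incl.comp f = LieHom.id := by
    refine FreeLieAlgebra.hom_ext fun s => ?_
    simp [f]
  refine LieDerivation.ext_of_lieSpan_eq_top (Set.range (FreeLieAlgebra.of F)) ?_ ?_
  · refine eq_top_iff.2 fun y _ => ?_
    have := LieHom.congr_fun hf y
    rw [LieHom.comp_apply, LieHom.id_apply] at this
    exact this ▸ (f y).2
  · rintro _ ⟨s, rfl⟩
    exact h s

theorem lieDerivation_sum_apply {R L M ι : Type*} [CommRing R] [LieRing L] [LieAlgebra R L]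
    [AddCommGroup M] [Module R M] [LieRingModule L M] [LieModule R L M]
    (t : Finset ι) (D : ι → LieDerivation R L M) (y : L) :
    (∑ β ∈ t, D β) y = ∑ β ∈ t, D β y := by
  induction t using Finset.cons_induction with
  | empty => simp
  | cons b t hb ih => simp [ih]

theorem isT.apply_of {F : Type} [Field F] {N : ℕ} {p q : Fin N} {T : DerL F N}
    (h : isT F p q T) (s : Fin N) :
    T (FreeLieAlgebra.of F s) = ⁅FreeLieAlgebra.of F s, eTup F N p q s⁆ := by
  obtain ⟨hp, hq, h0⟩ := h
  unfold eTup
  split_ifs with h1 h2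
  · obtain rfl := Fin.ext h1
    simpa [xg] using hp
  · obtain rfl := Fin.ext h2
    simpa [xg] using hq
  · simpa using h0 s (fun h => h1 (by rw [h])) (fun h => h2 (by rw [h]))

theorem tget_eTup (F : Type) [Field F] {M p q : ℕ} (hp : p < M) (hq : q < M) (r : ℕ) :
    tget F (eTup F M p q) r = if r = p then xg F M q else if r = q then xg F M p else 0 := by
  unfold tget eTup
  split_ifs <;> first | rfl | omega

theorem PhiL_xg (F : Type) [Field F] {m : ℕ} (n i : ℕ) {r : ℕ} (hr : r < m) :
    PhiL F m n i (xg F m r) =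
      if r < i then xg F (m + n - 1) r
      else if r = i then ∑ t : Fin n, xg F (m + n - 1) (i + (t : ℕ))
      else xg F (m + n - 1) (r + n - 1) := by
  simp [PhiL, xg, hr]

theorem PsiL_xg (F : Type) [Field F] (m : ℕ) {n : ℕ} (i : ℕ) {r : ℕ} (hr : r < n) :
    PsiL F m n i (xg F n r) = xg F (m + n - 1) (i + r) := by
  simp [PsiL, xg, hr]

/-- A sum of `n` consecutive Kronecker deltas. -/
theorem sum_ite_eq_add {A : Type*} [AddCommMonoid A] (n a s : ℕ) (c : A) :
    (∑ β : Fin n, if s = a + (β : ℕ) then c else 0) = if a ≤ s ∧ s < a + n then c else 0 := by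
  split_ifs with h
  · rw [Finset.sum_eq_single ⟨s - a, by omega⟩]
    · exact if_pos (by simp only; omega)
    · exact fun b _ hb => if_neg fun h' => hb (Fin.ext (by simp only; omega))
    · simp
  · exact Finset.sum_eq_zero fun β _ => if_neg (by have := β.isLt; omega)

theorem sum_eTup_left (F : Type) [Field F] {N n a b : ℕ} (hb : a + n ≤ b) (s : Fin N) :
    ∑ β : Fin n, eTup F N (a + (β : ℕ)) b s =
      if (s : ℕ) = b then ∑ β : Fin n, xg F N (a + (β : ℕ))
      else if a ≤ (s : ℕ) ∧ (s : ℕ) < a + n then xg F N b else 0 := by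
  unfold eTup
  split_ifs with h
  · refine Finset.sum_congr rfl fun β _ => ?_
    have := β.isLt
    rw [if_neg (by omega)]
  all_goals simp [sum_ite_eq_add, *]

theorem sum_eTup_right (F : Type) [Field F] {N n a b : ℕ} (s : Fin N) :
    ∑ β : Fin n, eTup F N b (a + (β : ℕ)) s =
      if (s : ℕ) = b then ∑ β : Fin n, xg F N (a + (β : ℕ))
      else if a ≤ (s : ℕ) ∧ (s : ℕ) < a + n then xg F N b else 0 := by
  unfold eTup
  split_ifs with h
  · rfl
  all_goals simp [sum_ite_eq_add, *]

/-- The operadic composition of two braid tuples, expressed through braid tuples. -/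
theorem compTup_eTup (F : Type) [Field F] {m n i j k l α : ℕ}
    (hij : i < j) (hjm : j < m) (hkl : k < l) (hln : l < n) (s : Fin (m + n - 1)) :
    compTup F (eTup F m i j) α (eTup F n k l) s =
      (if α < i then eTup F (m + n - 1) (i + n - 1) (j + n - 1) s
      else if α = i then ∑ β : Fin n, eTup F (m + n - 1) (i + (β : ℕ)) (j + n - 1) s
      else if α < j then eTup F (m + n - 1) i (j + n - 1) s
      else if α = j then ∑ β : Fin n, eTup F (m + n - 1) i (j + (β : ℕ)) s
      else eTup F (m + n - 1) i j s) +
      eTup F (m + n - 1) (k + α) (l + α) s := by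
  have hPhi (r : ℕ) : PhiL F m n α (tget F (eTup F m i j) r) =
      if r = i then PhiL F m n α (xg F m j)
      else if r = j then PhiL F m n α (xg F m i) else 0 := by
    rw [tget_eTup F (hij.trans hjm) hjm]
    split_ifs <;> simp
  have hPsi (r : ℕ) : PsiL F m n α (tget F (eTup F n k l) r) =
      if r = k then xg F (m + n - 1) (l + α)
      else if r = l then xg F (m + n - 1) (k + α) else 0 := by
    rw [tget_eTup F (hkl.trans hln) hln]
    split_ifs <;> simp [PsiL_xg, hln, hkl.trans hln, add_comm]
  rw [sum_eTup_left F (by omega), sum_eTup_right F]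
  simp only [compTup, hPhi, hPsi, PhiL_xg F n α hjm, PhiL_xg F n α (hij.trans hjm), eTup]
  rcases lt_trichotomy α i with h | rfl | h
  on_goal 3 => rcases lt_trichotomy α j with h' | rfl | h'
  all_goals
    simp (disch := omega) only [if_pos, if_neg]
    split_ifs <;> first | (exfalso; omega) | simp

/-- Composition of infinitesimal braid generators: the tangential derivation
`D_{e_{ij} ∘_α e_{kl}}` of `lie_{m+n-1}` equals `T + t^{(k+α)(l+α)}` where `T` is the
appropriate (sum of) `t`-generator(s) according to the position of the pivot `α`
relative to `i < j`.  All indices are 0-based: the paper's `1 ≤ i < j ≤ m`,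
`1 ≤ k < l ≤ n`, `1 ≤ α ≤ m` become `i < j < m`, `k < l < n`, `α < m`, and the paper's
target indices `(k+α-1, l+α-1)`, `(i+n-1, j+n-1)`, `(i+β-1, j+n-1)` (for `1 ≤ β ≤ n`),
`(i, j+n-1)`, `(i, j+β-1)`, `(i, j)` become `(k+α, l+α)`, `(i+n-1, j+n-1)`, `(i+β, j+n-1)`
(for `0 ≤ β < n`), `(i, j+n-1)`, `(i, j+β)`, `(i, j)` respectively. -/
theorem braid_generators_compose (m n : ℕ) (i j k l α : ℕ)
    (hij : i < j) (hjm : j < m) (hkl : k < l) (hln : l < n) (hα : α < m)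
    (tDer : Fin (m + n - 1) → Fin (m + n - 1) → DerL K (m + n - 1))
    (htDer : ∀ p q : Fin (m + n - 1), p ≠ q → isT K p q (tDer p q))
    (W : DerL K (m + n - 1))
    (hW : ∀ s : Fin (m + n - 1),
      W (FreeLieAlgebra.of K s) =
        ⁅FreeLieAlgebra.of K s, compTup K (eTup K m i j) α (eTup K n k l) s⁆) :
    W =
      (if α < i then
        tDer ⟨i + n - 1, by omega⟩ ⟨j + n - 1, by omega⟩
      else if α = i then
        ∑ β : Fin n,
          tDer ⟨i + (β : ℕ), by have := β.isLt; omega⟩ ⟨j + n - 1, by omega⟩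
      else if α < j then
        tDer ⟨i, by omega⟩ ⟨j + n - 1, by omega⟩
      else if α = j then
        ∑ β : Fin n, tDer ⟨i, by omega⟩ ⟨j + (β : ℕ), by have := β.isLt; omega⟩
      else tDer ⟨i, by omega⟩ ⟨j, by omega⟩) +
      tDer ⟨k + α, by omega⟩ ⟨l + α, by omega⟩ := by
  refine lieF_derivation_ext fun s => ?_
  rw [hW, compTup_eTup K hij hjm hkl hln, lie_add, LieDerivation.add_apply,
    (htDer _ _ (by simp only [ne_eq, Fin.mk.injEq]; omega)).apply_of]
  congr 1
  split_ifs
  · rw [(htDer _ _ (by simp only [ne_eq, Fin.mk.injEq]; omega)).apply_of]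
  · rw [lie_sum, lieDerivation_sum_apply]
    refine Finset.sum_congr rfl fun β _ => ?_
    have := β.isLt
    rw [(htDer _ _ (by simp only [ne_eq, Fin.mk.injEq]; omega)).apply_of]
  · rw [(htDer _ _ (by simp only [ne_eq, Fin.mk.injEq]; omega)).apply_of]
  · rw [lie_sum, lieDerivation_sum_apply]
    refine Finset.sum_congr rfl fun β _ => ?_
    rw [(htDer _ _ (by simp only [ne_eq, Fin.mk.injEq]; omega)).apply_of]
  · rw [(htDer _ _ (by simp only [ne_eq, Fin.mk.injEq]; omega)).apply_of]
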